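/- Let g be an l×m complex matrix of rank n (so n ≤ min(l,m)) and let s ∈ ℂ^n satisfy Re(s_j − s_{j+1}) ≥ 1 for j = 1,…,n (convention s_{n+1} = −1). Then the spherical functions of g and of its conjugate transpose g* coincide: Φ_{l,n}(s, L^{(n)}; g g*) = Φ_{m,n}(s, L^{(n)}; g* g), i.e. Ψ(s; g) = Ψ(s; g*). -/

import Mathlib

open MeasureTheory Matrix Finset Filter

noncomputable section

namespace RMT

instance matMS (l m : ℕ) : MeasurableSpace (Matrix (Fin l) (Fin m) ℂ) :=
  inferInstanceAs (MeasurableSpace (Fin l → Fin m → ℂ))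

/-- The real part of the determinant of the leading principal `j × j` submatrix. -/
def pminor {l : ℕ} (y : Matrix (Fin l) (Fin l) ℂ) (j : ℕ) : ℝ :=
  (Matrix.det (Matrix.of fun p q : Fin (min j l) =>
    y (Fin.castLE (min_le_right j l) p) (Fin.castLE (min_le_right j l) q))).re

/-- `s_{j+1}` with the convention `s_{n+1} = -1` (0-based index `j`). -/
def sNext (n : ℕ) (s : ℕ → ℂ) (j : ℕ) : ℂ := if j + 1 < n then s (j + 1) else -1

/-- `L_{j+1}` with the convention `L_{n+1} = -1` (0-based index `j`). -/
def LNext (n : ℕ) (L : ℕ → ℤ) (j : ℕ) : ℤ := if j + 1 < n then L (j + 1) else -1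

/-- The integrand of the spherical function `N_{l,n}(s,L;·)`. -/
def sphProd (n : ℕ) (s : ℕ → ℂ) (L : ℕ → ℤ) {l : ℕ} (y : Matrix (Fin l) (Fin l) ℂ) : ℂ :=
  ∏ j ∈ Finset.range n,
    if pminor y (j + 1) = 0 then 0
    else ((Real.sign (pminor y (j + 1)) : ℂ) ^ (L j - LNext n L j - 1)) *
      (((|pminor y (j + 1)| : ℝ) : ℂ) ^ (s j - sNext n s j - 1))

/-- The integrand of the normalization constant `C_{l,n}(s)`. -/
def absProd (n : ℕ) (s : ℕ → ℂ) {l : ℕ} (y : Matrix (Fin l) (Fin l) ℂ) : ℂ :=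
  ∏ j ∈ Finset.range n,
    if pminor y (j + 1) = 0 then 0
    else (((|pminor y (j + 1)| : ℝ) : ℂ) ^ (s j - sNext n s j - 1))

/-- `μ` is the normalized Haar probability measure of `U(l)`, viewed as a measure on the
space of `l × l` complex matrices: it is a probability measure, it is carried by the
unitary group, and it is invariant under left translation by every unitary matrix.
(These properties determine `μ` uniquely.) -/
def IsHaarUnitary (l : ℕ) (μ : Measure (Matrix (Fin l) (Fin l) ℂ)) : Prop :=
  IsProbabilityMeasure μ ∧ μ {A | A ∈ Matrix.unitaryGroup (Fin l) ℂ}ᶜ = 0 ∧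
    ∀ U ∈ Matrix.unitaryGroup (Fin l) ℂ, μ.map (fun A => U * A) = μ

/-- `N_{l,n}(s, L; x)`. -/
def Nsph (l n : ℕ) (μ : Measure (Matrix (Fin l) (Fin l) ℂ)) (s : ℕ → ℂ) (L : ℕ → ℤ)
    (x : Matrix (Fin l) (Fin l) ℂ) : ℂ :=
  ∫ k, sphProd n s L (k * x * kᴴ) ∂μ

/-- The l×l diagonal matrix with `n` ones followed by zeros. -/
def projMat (l n : ℕ) : Matrix (Fin l) (Fin l) ℂ :=
  Matrix.diagonal fun i => if (i : ℕ) < n then 1 else 0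

/-- The normalization `C_{l,n}(s)`. -/
def Csph (l n : ℕ) (μ : Measure (Matrix (Fin l) (Fin l) ℂ)) (s : ℕ → ℂ) : ℂ :=
  ∫ k, absProd n s (k * projMat l n * kᴴ) ∂μ

/-- The spherical function `Φ_{l,n}(s,L;x) = N_{l,n}(s,L;x)/C_{l,n}(s)`. -/
def Phi (l n : ℕ) (μ : Measure (Matrix (Fin l) (Fin l) ℂ)) (s : ℕ → ℂ) (L : ℕ → ℤ)
    (x : Matrix (Fin l) (Fin l) ℂ) : ℂ :=
  Nsph l n μ s L x / Csph l n μ s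

/-- `L^{(n)} = ((n-1) mod 2, (n-2) mod 2, …, 1, 0)`. -/
def Lstd (n : ℕ) : ℕ → ℤ := fun j => ((n - 1 - j : ℕ) : ℤ) % 2

/-- The spherical function `Ψ(s; g) = Φ_{l,n}(s, L^{(n)}; g g*)` for `g` of rank `n`. -/
def Psi (l m n : ℕ) (μ : Measure (Matrix (Fin l) (Fin l) ℂ)) (s : ℕ → ℂ)
    (g : Matrix (Fin l) (Fin m) ℂ) : ℂ :=
  Phi l n μ s (Lstd n) (g * gᴴ)

/-- The Vandermonde determinant `Δ_n(a) = ∏_{c>d} (a_c - a_d)` (complex version). -/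
def VdmC (n : ℕ) (a : ℕ → ℂ) : ℂ := ∏ c ∈ Finset.range n, ∏ d ∈ Finset.range c, (a c - a d)

/-- The Vandermonde determinant `Δ_n(a) = ∏_{c>d} (a_c - a_d)` (real version). -/
def VdmR (n : ℕ) (a : ℕ → ℝ) : ℝ := ∏ c ∈ Finset.range n, ∏ d ∈ Finset.range c, (a c - a d)

end RMT

namespace RMT


section gauss
open Module
variable (E : Type*) [NormedAddCommGroup E] [InnerProductSpace ℝ E] [FiniteDimensional ℝ E]
  [MeasurableSpace E] [BorelSpace E]

/-- normalizing constant -/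
def gc : ℝ := (Real.pi ^ ((finrank ℝ E : ℝ) / 2))⁻¹

/-- Gaussian measure with density `c exp(-‖x‖²)`. -/
def gau : Measure E :=
  (volume : Measure E).withDensity (fun x => ENNReal.ofReal (gc E * Real.exp (-‖x‖ ^ 2)))

lemma gc_pos : 0 < gc E := by unfold gc; positivity

variable {E}
lemma integral_gau (f : E → ℂ) :
    ∫ x, f x ∂(gau E) = (gc E : ℂ) * ∫ x, (Real.exp (-‖x‖ ^ 2) : ℂ) * f x := by
  unfold gau
  rw [integral_withDensity_eq_integral_toReal_smul (by fun_prop) (by simp), ← integral_const_mul]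
  congr 1; ext x
  rw [ENNReal.toReal_ofReal (by have := gc_pos E; positivity)]
  simp [mul_assoc]

lemma integrable_exp_gau (a : ℝ) : Integrable (fun x : E => Real.exp (a * ‖x‖)) (gau E) := by
  have h0 : Integrable (fun x : E => Real.exp (-(1/2) * ‖x‖ ^ 2)) := by
    have : Integrable (fun x : E => Complex.exp (-(1/2) * ‖x‖ ^ 2)) := by
      apply MeasureTheory.Integrable.of_integral_ne_zero
      rw [show (-(1/2) : ℂ) = - (1/2 : ℂ) by norm_num,
        GaussianFourier.integral_cexp_neg_mul_sq_norm (by norm_num)]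
      simp [Complex.cpow_eq_zero_iff, Real.pi_ne_zero]
    convert! this.re using 2 with x
    rw [show (-(1/2) * (‖x‖ : ℂ) ^ 2) = ((-(1/2) * ‖x‖ ^ 2 : ℝ) : ℂ) by push_cast; ring, 
      ← Complex.ofReal_exp]
    exact (Complex.ofReal_re _).symm
  unfold gau
  rw [integrable_withDensity_iff_integrable_smul₀' (by fun_prop) (by simp)]
  refine Integrable.mono' (h0.const_mul (gc E * Real.exp (a ^ 2 / 2))) (by fun_prop) (.of_forall fun x => ?_)
  rw [ENNReal.toReal_ofReal (by have := gc_pos E; positivity)]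
  have := gc_pos E
  rw [smul_eq_mul, Real.norm_of_nonneg (by positivity), mul_assoc, mul_assoc, ← Real.exp_add, ← Real.exp_add]
  refine mul_le_mul_of_nonneg_left (Real.exp_le_exp.2 ?_) this.le
  nlinarith [sq_nonneg (‖x‖ - a)]

lemma charFun_gau (t : E) : charFun (gau E) t = Complex.exp (-‖t‖ ^ 2 / 4) := by
  rw [charFun_apply, integral_gau]
  have h := GaussianFourier.integral_cexp_neg_mul_sq_norm_add (b := 1) (by simp) Complex.I t
  have : ∀ x : E, ((Real.exp (-‖x‖ ^ 2) : ℝ) : ℂ) * Complex.exp (inner ℝ x t * Complex.I)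
      = Complex.exp (-1 * ‖x‖ ^ 2 + Complex.I * inner ℝ t x) := by
    intro x
    rw [Complex.ofReal_exp, ← Complex.exp_add, real_inner_comm]
    push_cast; ring_nf
  simp_rw [this]
  rw [h, ← mul_assoc]
  have : (gc E : ℂ) * (Real.pi / 1) ^ ((finrank ℝ E : ℂ) / 2) = 1 := by
    unfold gc
    rw [div_one, show ((finrank ℝ E : ℂ) / 2) = (((finrank ℝ E : ℝ) / 2 : ℝ) : ℂ) by push_cast; ring,
      ← Complex.ofReal_cpow Real.pi_pos.le, ← Complex.ofReal_mul, inv_mul_cancel₀ (by positivity)]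
    simp
  rw [this]; simp

instance : IsProbabilityMeasure (gau E) := by
  have h1 : Integrable (fun x : E => Real.exp (0 * ‖x‖)) (gau E) := integrable_exp_gau 0
  have hf : IsFiniteMeasure (gau E) := by
    simp only [zero_mul, Real.exp_zero] at h1
    rw [integrable_const_iff] at h1
    simpa using h1
  have := charFun_gau (0 : E)
  simp [charFun_zero] at this
  exact ⟨by
    have h2 : (gau E).real Set.univ = 1 := by exact_mod_cast this
    rw [measureReal_def] at h2
    rwa [ENNReal.toReal_eq_one_iff] at h2⟩

lemma map_gau {F : Type*} [NormedAddCommGroup F] [InnerProductSpace ℝ F] [FiniteDimensional ℝ F]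
    [MeasurableSpace F] [BorelSpace F] (L : E → F) (M : F → E) (hL : Measurable L)
    (h : ∀ x t, inner ℝ (L x) t = inner ℝ x (M t)) (hM : ∀ t, ‖M t‖ = ‖t‖) :
    (gau E).map L = gau F := by
  have : IsProbabilityMeasure ((gau E).map L) := Measure.isProbabilityMeasure_map hL.aemeasurable
  apply Measure.ext_of_charFun
  ext t
  rw [charFun_gau, charFun_apply, integral_map hL.aemeasurable (by fun_prop)]
  simp_rw [h]
  rw [← charFun_apply, charFun_gau, hM]

/-- power with value zero at zero -/
def zpw (w : ℂ) (x : ℝ) : ℂ := if x = 0 then 0 else ((|x| : ℝ) : ℂ) ^ w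

lemma moment_gau [Nontrivial E] (w : ℂ) (hw : 0 ≤ w.re) :
    ∫ x, zpw w (‖x‖ ^ 2) ∂(gau E) ≠ 0 := by
  rw [integral_gau]
  refine mul_ne_zero (by exact_mod_cast (gc_pos E).ne') ?_
  have := integral_fun_norm_addHaar (volume : Measure E)
    (fun r => ((Real.exp (-r ^ 2) : ℝ) : ℂ) * zpw w (r ^ 2))
  rw [this]
  have hd : 0 < finrank ℝ E := finrank_pos
  rw [nsmul_eq_mul]
  refine mul_ne_zero (by exact_mod_cast hd.ne') ?_
  refine smul_ne_zero ?_ ?_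
  · rw [measureReal_def]
    exact (ENNReal.toReal_pos (Metric.measure_ball_pos _ _ one_pos).ne' measure_ball_lt_top.ne).ne'
  set d := finrank ℝ E with hdd
  have key := integral_comp_rpow_Ioi_of_pos (g := fun t : ℝ => (t : ℂ) ^ (((d : ℂ) / 2 + w) - 1) * Complex.exp (-((1:ℝ) * t))) (p := 2) two_pos
  have hg := Complex.integral_cpow_mul_exp_neg_mul_Ioi (a := (d : ℂ) / 2 + w) (r := 1) (by
    have : (0:ℝ) < d := by exact_mod_cast hd
    have h2 : ((d : ℂ) / 2).re = d / 2 := by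
      rw [show ((d : ℂ) / 2) = (((d:ℝ) / 2 : ℝ) : ℂ) by push_cast; ring, Complex.ofReal_re]
    rw [Complex.add_re, h2]; positivity) one_pos
  have hG := Complex.Gamma_ne_zero_of_re_pos (s := (d : ℂ) / 2 + w) (by
    have : (0:ℝ) < d := by exact_mod_cast hd
    have h2 : ((d : ℂ) / 2).re = d / 2 := by
      rw [show ((d : ℂ) / 2) = (((d:ℝ) / 2 : ℝ) : ℂ) by push_cast; ring, Complex.ofReal_re]
    rw [Complex.add_re, h2]; positivity)
  rw [hg] at key
  have e : ∫ y in Set.Ioi (0:ℝ), y ^ (d - 1) • (((Real.exp (-y ^ 2) : ℝ) : ℂ) * zpw w (y ^ 2))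
      = (1/2 : ℂ) * ((1 / (1:ℝ)) ^ ((d : ℂ) / 2 + w) * Complex.Gamma ((d : ℂ) / 2 + w)) := by
    rw [← key, ← integral_const_mul]
    refine setIntegral_congr_fun measurableSet_Ioi fun y hy => ?_
    have hy : 0 < y := hy
    have hyc : (y : ℂ) ≠ 0 := by exact_mod_cast hy.ne'
    simp only [zpw, hy.ne', pow_eq_zero_iff, ne_eq, OfNat.ofNat_ne_zero, not_false_eq_true, if_false]
    rw [abs_of_pos (by positivity), Complex.real_smul, Complex.real_smul]
    have e1 : (((y ^ 2 : ℝ)) : ℂ) ^ w = (y : ℂ) ^ (2 * w) := by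
      push_cast
      rw [sq, Complex.mul_cpow_ofReal_nonneg hy.le hy.le, ← Complex.cpow_add _ _ hyc]
      ring_nf
    have e2 : (((y ^ (2:ℝ) : ℝ)) : ℂ) ^ ((d : ℂ) / 2 + w - 1) = (y : ℂ) ^ (d + 2 * w - 2) := by
      rw [Real.rpow_two]
      push_cast
      rw [sq, Complex.mul_cpow_ofReal_nonneg hy.le hy.le, ← Complex.cpow_add _ _ hyc]
      ring_nf
    rw [e1, e2, Real.rpow_two]
    have e3 : ((y ^ (d - 1) : ℝ) : ℂ) = (y : ℂ) ^ ((d : ℂ) - 1) := by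
      rw [Complex.ofReal_pow, ← Complex.cpow_natCast, Nat.cast_sub hd]; simp
    rw [e3]
    have e4 : (y : ℂ) ^ ((d : ℂ) + 2 * w - 2) * y = (y : ℂ) ^ ((d : ℂ) - 1) * (y : ℂ) ^ (2 * w) := by
      nth_rewrite 2 [← Complex.cpow_one (y : ℂ)]
      rw [← Complex.cpow_add _ _ hyc, ← Complex.cpow_add _ _ hyc]; ring_nf
    have e5 : (2 - 1 : ℝ) = 1 := by norm_num
    rw [e5, Real.rpow_one]
    push_cast
    rw [one_mul]
    linear_combination (-Complex.exp (-(y:ℂ)^2)) * e4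
  rw [e]
  simp [hG]
end gauss

section linalg
open scoped ComplexOrder

lemma pminor_eq {l : ℕ} (y : Matrix (Fin l) (Fin l) ℂ) (j : ℕ) (h : j ≤ l) :
    pminor y j = (y.submatrix (Fin.castLE h) (Fin.castLE h)).det.re := by
  have hm : min j l = j := min_eq_left h
  unfold pminor
  rw [← Matrix.det_submatrix_equiv_self (finCongr hm.symm)]
  rfl

/-- truncation of a product with a lower triangular matrix -/
lemma pminor_tri {n : ℕ} (T y : Matrix (Fin n) (Fin n) ℂ) (hT : ∀ i j, i < j → T i j = 0)
    (j : ℕ) (h : j ≤ n) :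
    pminor (T * y * Tᴴ) j =
      Complex.normSq (T.submatrix (Fin.castLE h) (Fin.castLE h)).det * pminor y j := by
  rw [pminor_eq _ _ h, pminor_eq _ _ h]
  have key : ∀ (z : Fin n → ℂ) (i : Fin j), ∑ k, T (Fin.castLE h i) k * z k
      = ∑ k : Fin j, T (Fin.castLE h i) (Fin.castLE h k) * z (Fin.castLE h k) := by
    intro z i
    symm
    refine (Finset.sum_map Finset.univ (Fin.castLEEmb h)
      (fun k => T (Fin.castLE h i) k * z k)).symm.trans ?_
    refine Finset.sum_subset (Finset.subset_univ _) fun k _ hk => ?_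
    rw [hT, zero_mul]
    by_contra hlt
    apply hk
    rw [Finset.mem_map]
    have : (k : ℕ) < j := by
      have h1 : (k : ℕ) ≤ i := by simpa [Fin.lt_def] using hlt
      omega
    exact ⟨⟨k, this⟩, Finset.mem_univ _, rfl⟩
  have e : (T * y * Tᴴ).submatrix (Fin.castLE h) (Fin.castLE h)
      = T.submatrix (Fin.castLE h) (Fin.castLE h) * y.submatrix (Fin.castLE h) (Fin.castLE h)
        * (T.submatrix (Fin.castLE h) (Fin.castLE h))ᴴ := by
    ext a b
    rw [Matrix.mul_assoc, Matrix.mul_assoc]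
    simp only [submatrix_apply, Matrix.mul_apply, conjTranspose_apply]
    rw [key (fun k => ∑ x, y k x * star (T (Fin.castLE h b) x))]
    refine Finset.sum_congr rfl fun k _ => ?_
    congr 1
    have := key (fun x => star (y (Fin.castLE h k) x)) b
    have h2 := congrArg star this
    simp only [star_sum, star_mul, star_star] at h2
    exact h2
  rw [e, Matrix.det_mul, Matrix.det_mul, Matrix.det_conjTranspose]
  rw [show ∀ a b : ℂ, a * b * star a = (Complex.normSq a : ℂ) * b by
    intro a b
    rw [mul_right_comm, Complex.star_def, Complex.mul_conj]]
  rw [Complex.re_ofReal_mul]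

lemma pminor_one {n : ℕ} (j : ℕ) (h : j ≤ n) : pminor (1 : Matrix (Fin n) (Fin n) ℂ) j = 1 := by
  rw [pminor_eq _ _ h, submatrix_one _ (Fin.castLE_injective h)]
  simp

lemma pminor_nonneg {l : ℕ} {y : Matrix (Fin l) (Fin l) ℂ} (hy : y.PosSemidef) (j : ℕ)
    (h : j ≤ l) : 0 ≤ pminor y j := by
  rw [pminor_eq _ _ h]
  exact (Complex.le_def.1 (hy.submatrix (Fin.castLE h)).det_nonneg).1

lemma pminor_top {n : ℕ} (y : Matrix (Fin n) (Fin n) ℂ) : pminor y n = y.det.re := by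
  rw [pminor_eq _ _ le_rfl]; rfl

/-- the corner -/
lemma pminor_sub {l n : ℕ} (hnl : n ≤ l) (z : Matrix (Fin l) (Fin l) ℂ) (j : ℕ) (h : j ≤ n) :
    pminor (z.submatrix (Fin.castLE hnl) (Fin.castLE hnl)) j = pminor z j := by
  rw [pminor_eq _ _ h, pminor_eq _ _ (h.trans hnl)]; rfl

/-- weighted product of minors -/
def fprod (n : ℕ) (w : ℕ → ℂ) {l : ℕ} (y : Matrix (Fin l) (Fin l) ℂ) : ℂ :=
  ∏ j ∈ Finset.range n, zpw (w j) (pminor y (j + 1))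

lemma absProd_eq (n : ℕ) (s : ℕ → ℂ) {l : ℕ} (y : Matrix (Fin l) (Fin l) ℂ) :
    absProd n s y = fprod n (fun j => s j - sNext n s j - 1) y := rfl

lemma sphProd_eq (n : ℕ) (s : ℕ → ℂ) (L : ℕ → ℤ) {l : ℕ} (hnl : n ≤ l)
    (y : Matrix (Fin l) (Fin l) ℂ) (hy : y.PosSemidef) :
    sphProd n s L y = fprod n (fun j => s j - sNext n s j - 1) y := by
  unfold sphProd fprod
  refine Finset.prod_congr rfl fun j hj => ?_
  rw [Finset.mem_range] at hj
  unfold zpw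
  split_ifs with h
  · rfl
  · have := lt_of_le_of_ne (pminor_nonneg hy (j+1) (by omega)) (Ne.symm h)
    rw [Real.sign_of_pos this]; simp

lemma zpw_mul (w : ℂ) (a b : ℝ) : zpw w (a * b) = zpw w a * zpw w b := by
  unfold zpw
  by_cases ha : a = 0
  · simp [ha]
  by_cases hb : b = 0
  · simp [hb]
  rw [if_neg (mul_ne_zero ha hb), if_neg ha, if_neg hb, abs_mul, Complex.ofReal_mul,
    Complex.mul_cpow_ofReal_nonneg (abs_nonneg _) (abs_nonneg _)]

lemma zpw_one (w : ℂ) : zpw w 1 = 1 := by simp [zpw]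

lemma zpw_add (w v : ℂ) (a : ℝ) : zpw (w + v) a = zpw w a * zpw v a := by
  unfold zpw
  by_cases ha : a = 0
  · simp [ha]
  rw [if_neg ha, if_neg ha, if_neg ha, Complex.cpow_add]
  simpa using ha

lemma fprod_mul (n : ℕ) (w : ℕ → ℂ) {a b c : ℕ} (x : Matrix (Fin a) (Fin a) ℂ)
    (y : Matrix (Fin b) (Fin b) ℂ) (z : Matrix (Fin c) (Fin c) ℂ)
    (h : ∀ j ≤ n, pminor x j = pminor y j * pminor z j) :
    fprod n w x = fprod n w y * fprod n w z := by
  unfold fprod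
  rw [← Finset.prod_mul_distrib]
  refine Finset.prod_congr rfl fun j hj => ?_
  rw [Finset.mem_range] at hj
  rw [h _ (by omega), zpw_mul]

lemma fprod_congr (n : ℕ) (w : ℕ → ℂ) {a b : ℕ} (x : Matrix (Fin a) (Fin a) ℂ)
    (y : Matrix (Fin b) (Fin b) ℂ) (h : ∀ j ≤ n, pminor x j = pminor y j) :
    fprod n w x = fprod n w y := by
  unfold fprod
  refine Finset.prod_congr rfl fun j hj => ?_
  rw [Finset.mem_range] at hj
  rw [h _ (by omega)]

/-- Orthonormalization of the rows of a full rank matrix. -/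
lemma exists_LQ {n p : ℕ} (G : Matrix (Fin n) (Fin p) ℂ) (hG : (G * Gᴴ).det ≠ 0) :
    ∃ T : Matrix (Fin n) (Fin n) ℂ, (∀ i j, i < j → T i j = 0) ∧ (T * G) * (T * G)ᴴ = 1 := by
  have hps : (G * Gᴴ).PosSemidef := posSemidef_self_mul_conjTranspose G
  have hS : (G * Gᴴ).PosDef := (hps.posDef_iff_det_ne_zero).2 hG
  set M := LDL.lowerInv hS with hM
  have hD := LDL.diag_eq_lowerInv_conj hS
  have hDp : (LDL.diag hS).PosDef := by
    rw [hD]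
    refine hS.mul_mul_conjTranspose_same ?_
    refine Matrix.vecMul_injective_of_isUnit ?_
    exact isUnit_of_invertible _
  unfold LDL.diag at hDp hD
  rw [Matrix.posDef_diagonal_iff] at hDp
  set d := LDL.diagEntries hS
  have hd : ∀ i, ∃ r : ℝ, 0 < r ∧ d i = r := fun i =>
    ⟨(d i).re, (Complex.pos_iff.1 (hDp i)).1, by
      apply Complex.ext <;> simp [(Complex.pos_iff.1 (hDp i)).2.symm]⟩
  choose r hr hdr using hd
  refine ⟨diagonal (fun i => (((Real.sqrt (r i))⁻¹ : ℝ) : ℂ)) * M, fun i j hij => ?_, ?_⟩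
  · rw [diagonal_mul, show M i j = 0 from LDL.lowerInv_triangular hS hij, mul_zero]
  · have : diagonal (fun i => (((Real.sqrt (r i))⁻¹ : ℝ) : ℂ)) * M * G *
       (diagonal (fun i => (((Real.sqrt (r i))⁻¹ : ℝ) : ℂ)) * M * G)ᴴ
       = diagonal (fun i => (((Real.sqrt (r i))⁻¹ : ℝ) : ℂ)) * (M * (G * Gᴴ) * Mᴴ) *
       (diagonal (fun i => (((Real.sqrt (r i))⁻¹ : ℝ) : ℂ)))ᴴ := by
      simp only [conjTranspose_mul, Matrix.mul_assoc]
    rw [this, ← hD, diagonal_conjTranspose, diagonal_mul_diagonal, diagonal_mul_diagonal, ← diagonal_one]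
    congr 1
    ext i
    have h3 : Real.sqrt (r i) ≠ 0 := (Real.sqrt_pos.2 (hr i)).ne'
    simp only [Pi.star_apply, Complex.star_def, Complex.conj_ofReal, hdr]
    rw [← Complex.ofReal_mul, ← Complex.ofReal_mul]
    norm_cast
    nth_rewrite 2 [← Real.mul_self_sqrt (hr i).le]
    field_simp

lemma exists_unitary {n p : ℕ} (hnp : n ≤ p) (K : Matrix (Fin n) (Fin p) ℂ) (hK : K * Kᴴ = 1) :
    ∃ U ∈ Matrix.unitaryGroup (Fin p) ℂ, U.submatrix (Fin.castLE hnp) id = K := by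
  let v : Fin p → EuclideanSpace ℂ (Fin p) := fun i =>
    if h : (i : ℕ) < n then WithLp.toLp 2 (fun q => K ⟨i, h⟩ q) else 0
  have hv : Orthonormal ℂ (({i | (i : ℕ) < n} : Set (Fin p)).domRestrict v) := by
    rw [orthonormal_iff_ite]
    rintro ⟨i, hi⟩ ⟨j, hj⟩
    have hi : (i : ℕ) < n := hi
    have hj : (j : ℕ) < n := hj
    have := congrFun (congrFun hK ⟨j, hj⟩) ⟨i, hi⟩
    rw [Matrix.mul_apply, Matrix.one_apply] at this
    have hvi : v i = WithLp.toLp 2 (fun q => K ⟨i, hi⟩ q) := dif_pos hi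
    have hvj : v j = WithLp.toLp 2 (fun q => K ⟨j, hj⟩ q) := dif_pos hj
    change inner ℂ (v i) (v j) = _
    rw [hvi, hvj, EuclideanSpace.inner_toLp_toLp]
    simp only [conjTranspose_apply] at this
    refine this.trans ?_
    simp [Fin.ext_iff, eq_comm]
  obtain ⟨b, hb⟩ := hv.exists_orthonormalBasis_extension_of_card_eq (by simp)
  refine ⟨Matrix.of fun i j => b i j, ?_, ?_⟩
  · rw [Matrix.mem_unitaryGroup_iff, star_eq_conjTranspose]
    ext i j
    have := orthonormal_iff_ite.1 b.orthonormal j i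
    rw [PiLp.inner_apply] at this
    simp only [Matrix.mul_apply, conjTranspose_apply, of_apply, Matrix.one_apply]
    simp only [RCLike.inner_apply] at this
    rw [eq_comm] at this
    simp only [eq_comm (a := j)] at this
    rw [this]
    rfl
  · ext i j
    have := hb (Fin.castLE hnp i) (by simp)
    simp [this, v]

/-- multiplicativity of minors -/
lemma exists_unitary_minor {n p : ℕ} (hnp : n ≤ p) (G : Matrix (Fin n) (Fin p) ℂ)
    (hG : (G * Gᴴ).det ≠ 0) : ∃ U ∈ Matrix.unitaryGroup (Fin p) ℂ,
      ∀ z : Matrix (Fin p) (Fin p) ℂ, ∀ j ≤ n,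
        pminor (G * z * Gᴴ) j = pminor (G * Gᴴ) j * pminor (U * z * Uᴴ) j := by
  obtain ⟨T, hT, hK⟩ := exists_LQ G hG
  obtain ⟨U, hU, hUK⟩ := exists_unitary hnp _ hK
  refine ⟨U, hU, fun z j hj => ?_⟩
  have h1 := pminor_tri T (G * z * Gᴴ) hT j hj
  have h2 := pminor_tri T (G * Gᴴ) hT j hj
  have e1 : T * (G * z * Gᴴ) * Tᴴ = (U * z * Uᴴ).submatrix (Fin.castLE hnp) (Fin.castLE hnp) := by
    rw [← submatrix_mul_equiv _ _ _ (Equiv.refl _) _, ← submatrix_mul_equiv _ _ _ (Equiv.refl _) _]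
    have : (Uᴴ.submatrix id (Fin.castLE hnp)) = (T * G)ᴴ := by rw [← hUK]; rfl
    simp only [Equiv.coe_refl, hUK, this, conjTranspose_mul, submatrix_id_id, Matrix.mul_assoc]
  have e2 : T * (G * Gᴴ) * Tᴴ = 1 := by
    rw [← hK]; simp only [conjTranspose_mul, Matrix.mul_assoc]
  rw [e1, pminor_sub hnp _ _ hj] at h1
  rw [e2, pminor_one _ hj] at h2
  rw [h1]
  linear_combination (-pminor (G * z * Gᴴ) j) * (-h2)

end linalg


instance matBS (l m : ℕ) : BorelSpace (Matrix (Fin l) (Fin m) ℂ) :=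
  inferInstanceAs (BorelSpace (Fin l → Fin m → ℂ))

instance matSC (l m : ℕ) : SecondCountableTopology (Matrix (Fin l) (Fin m) ℂ) :=
  inferInstanceAs (SecondCountableTopology (Fin l → Fin m → ℂ))

/-- row space -/
abbrev Er (p : ℕ) := PiLp 2 (fun _ : Fin p => ℂ)

/-- Gaussian measure on matrices, row by row -/
def gam (n p : ℕ) : Measure (Fin n → Er p) := Measure.pi (fun _ => gau (Er p))

instance (n p : ℕ) : IsProbabilityMeasure (gam n p) := by unfold gam; infer_instance

/-- the matrix with given rows -/
def toM {n p : ℕ} (x : Fin n → Er p) : Matrix (Fin n) (Fin p) ℂ := Matrix.of fun i j => x i j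

lemma continuous_toM {n p : ℕ} : Continuous (toM : (Fin n → Er p) → _) := by
  unfold toM
  refine continuous_matrix fun i j => ?_
  simp only [of_apply]
  fun_prop

/-- right multiplication of a row -/
def rowL {p q : ℕ} (V : Matrix (Fin p) (Fin q) ℂ) (x : Er p) : Er q :=
  WithLp.toLp 2 (fun j => ∑ k, x k * V k j)

lemma continuous_rowL {p q : ℕ} (V : Matrix (Fin p) (Fin q) ℂ) : Continuous (rowL V) := by
  unfold rowL
  fun_prop

lemma toM_rowL {n p q : ℕ} (V : Matrix (Fin p) (Fin q) ℂ) (x : Fin n → Er p) :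
    toM (fun i => rowL V (x i)) = toM x * V := by
  ext i j; simp [toM, rowL, Matrix.mul_apply]

lemma inner_rowL {p q : ℕ} (V : Matrix (Fin p) (Fin q) ℂ) (x : Er p) (t : Er q) :
    inner ℝ (rowL V x) t = inner ℝ x (rowL Vᴴ t) := by
  rw [PiLp.inner_apply, PiLp.inner_apply]
  simp only [rowL, Complex.inner, conjTranspose_apply, map_sum, Finset.sum_mul, Finset.mul_sum,
    Complex.re_sum]
  rw [Finset.sum_comm]
  refine Finset.sum_congr rfl fun k _ => Finset.sum_congr rfl fun j _ => ?_
  congr 1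
  simp only [map_mul, Complex.star_def]; ring

lemma rowL_rowL {p q r : ℕ} (V : Matrix (Fin p) (Fin q) ℂ) (W : Matrix (Fin q) (Fin r) ℂ)
    (x : Er p) : rowL W (rowL V x) = rowL (V * W) x := by
  ext j
  simp only [rowL, Matrix.mul_apply, Finset.mul_sum, Finset.sum_mul]
  rw [Finset.sum_comm]
  simp only [mul_assoc]

lemma rowL_one {p : ℕ} (x : Er p) : rowL 1 x = x := by
  ext j
  simp [rowL, Matrix.one_apply]

lemma map_row {p q : ℕ} (V : Matrix (Fin p) (Fin q) ℂ) (hV : Vᴴ * V = 1) :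
    (gau (Er p)).map (rowL V) = gau (Er q) := by
  refine map_gau _ (rowL Vᴴ) (continuous_rowL V).measurable (inner_rowL V) fun t => ?_
  have : ‖rowL Vᴴ t‖ ^ 2 = ‖t‖ ^ 2 := by
    rw [← real_inner_self_eq_norm_sq, ← inner_rowL, rowL_rowL, hV, rowL_one,
      real_inner_self_eq_norm_sq]
  exact (sq_eq_sq₀ (norm_nonneg _) (norm_nonneg _)).1 this

lemma map_gam {n p q : ℕ} (V : Matrix (Fin p) (Fin q) ℂ) (hV : Vᴴ * V = 1) :
    (gam n p).map (fun x i => rowL V (x i)) = gam n q := by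
  unfold gam
  have : ∀ i : Fin n, SigmaFinite (Measure.map (rowL V) (gau (Er p))) := by
    intro i; rw [map_row V hV]; infer_instance
  rw [Measure.pi_map_pi (fun _ => (continuous_rowL V).measurable.aemeasurable)]
  simp_rw [map_row V hV]

lemma integral_gam_mul {n p q : ℕ} (V : Matrix (Fin p) (Fin q) ℂ) (hV : Vᴴ * V = 1)
    (F : Matrix (Fin n) (Fin q) ℂ → ℂ) (hF : Measurable F) :
    ∫ x, F (toM x * V) ∂(gam n p) = ∫ x, F (toM x) ∂(gam n q) := by
  rw [← map_gam V hV, integral_map]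
  · simp_rw [toM_rowL]
  · have := continuous_rowL V
    exact (by fun_prop : Continuous (fun (x : Fin n → Er p) i => rowL V (x i))).measurable.aemeasurable
  · exact (hF.comp continuous_toM.measurable).aestronglyMeasurable

lemma measurable_zpw (w : ℂ) : Measurable (zpw w) := by
  unfold zpw
  refine Measurable.ite (measurableSet_singleton 0) measurable_const ?_
  have : Measurable (fun x : ℝ => ((|x| : ℝ) : ℂ)) := by
    exact Complex.measurable_ofReal.comp (by fun_prop)
  exact this.pow_const w

lemma continuous_pminor {l : ℕ} (j : ℕ) :
    Continuous (fun y : Matrix (Fin l) (Fin l) ℂ => pminor y j) := by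
  unfold pminor
  refine Complex.continuous_re.comp (Continuous.matrix_det ?_)
  refine continuous_matrix fun a b => ?_
  simp only [of_apply]
  exact continuous_id.matrix_elem _ _

lemma measurable_fprod (n : ℕ) (w : ℕ → ℂ) {l : ℕ} :
    Measurable (fun y : Matrix (Fin l) (Fin l) ℂ => fprod n w y) := by
  unfold fprod
  refine Finset.measurable_fun_prod _ fun j _ => ?_
  exact (measurable_zpw _).comp (continuous_pminor _).measurable

lemma norm_zpw_le (w : ℂ) (x : ℝ) : ‖zpw w x‖ ≤ |x| ^ w.re := by
  unfold zpw
  split_ifs with h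
  · simp only [norm_zero]; positivity
  · rw [Complex.norm_cpow_eq_rpow_re_of_pos (abs_pos.2 h)]

lemma abs_pminor_le {l : ℕ} (y : Matrix (Fin l) (Fin l) ℂ) (j : ℕ) (hj : j ≤ l) (B : ℝ)
    (hB : ∀ a b, ‖y a b‖ ≤ B) : |pminor y j| ≤ (j.factorial : ℝ) * B ^ j := by
  rw [pminor_eq _ _ hj]
  refine (Complex.abs_re_le_norm _).trans ?_
  have := Matrix.det_le (A := y.submatrix (Fin.castLE hj) (Fin.castLE hj))
    (abv := (IsAbsoluteValue.toAbsoluteValue (norm : ℂ → ℝ))) (x := B) (fun a b => hB _ _)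
  simpa [nsmul_eq_mul] using this

lemma fprod_bound (n : ℕ) (w : ℕ → ℂ) (hw : ∀ j < n, 0 ≤ (w j).re) {l : ℕ} (hnl : n ≤ l) (c : ℝ)
    (hc : 0 ≤ c) : ∃ C a : ℝ, ∀ (y : Matrix (Fin l) (Fin l) ℂ) (t : ℝ),
      (∀ p q, ‖y p q‖ ≤ c * Real.exp (2 * t)) → ‖fprod n w y‖ ≤ C * Real.exp (a * t) := by
  refine ⟨∏ j ∈ Finset.range n, (((j+1).factorial : ℝ) * c ^ (j+1)) ^ (w j).re,
    ∑ j ∈ Finset.range n, 2 * (j + 1) * (w j).re, fun y t h => ?_⟩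
  rw [Finset.sum_mul, Real.exp_sum, ← Finset.prod_mul_distrib, fprod, norm_prod]
  refine Finset.prod_le_prod (fun _ _ => norm_nonneg _) fun j hj => ?_
  rw [Finset.mem_range] at hj
  refine (norm_zpw_le _ _).trans ?_
  have h1 := abs_pminor_le y (j+1) (by omega) _ h
  refine (Real.rpow_le_rpow (abs_nonneg _) h1 (hw j hj)).trans ?_
  rw [mul_pow, ← mul_assoc, Real.mul_rpow (by positivity) (by positivity), ← Real.exp_nat_mul,
    ← Real.exp_mul]
  push_cast
  apply le_of_eq
  ring_nf

lemma norm_entry_le {n p : ℕ} (x : Fin n → Er p) (i : Fin n) (k : Fin p) :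
    ‖toM x i k‖ ≤ Real.exp (∑ i, ‖x i‖) := by
  have h1 : ‖toM x i k‖ ≤ ‖x i‖ := PiLp.norm_apply_le (x i) k
  have h2 : ‖x i‖ ≤ ∑ i, ‖x i‖ :=
    Finset.single_le_sum (f := fun i => ‖x i‖) (fun _ _ => norm_nonneg _) (Finset.mem_univ i)
  have h3 := Real.add_one_le_exp (∑ i, ‖x i‖)
  linarith

lemma norm_conj_le {n p : ℕ} (x : Fin n → Er p) (z : Matrix (Fin p) (Fin p) ℂ) (c : ℝ)
    (hz : ∀ a b, ‖z a b‖ ≤ c) (a b : Fin n) :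
    ‖(toM x * z * (toM x)ᴴ) a b‖ ≤ (p * p * c) * Real.exp (2 * ∑ i, ‖x i‖) := by
  set e := Real.exp (∑ i, ‖x i‖)
  have he : Real.exp (2 * ∑ i, ‖x i‖) = e * e := by rw [two_mul, Real.exp_add]
  rw [he]
  simp only [Matrix.mul_apply, conjTranspose_apply]
  have h0 : 0 ≤ e := (Real.exp_pos _).le
  calc _ ≤ ∑ k' : Fin p, ∑ k : Fin p, e * c * e := by
        refine (norm_sum_le _ _).trans (Finset.sum_le_sum fun k' _ => ?_)
        rw [norm_mul, norm_star, ← Finset.sum_mul]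
        refine mul_le_mul ?_ (norm_entry_le x b k') (norm_nonneg _) ?_
        · refine (norm_sum_le _ _).trans (Finset.sum_le_sum fun k _ => ?_)
          rw [norm_mul]
          exact mul_le_mul (norm_entry_le x a k) (hz _ _) (norm_nonneg _) h0
        · exact Finset.sum_nonneg fun k _ => mul_nonneg h0 ((norm_nonneg _).trans (hz k k))
    _ = _ := by simp; ring

lemma integrable_exp_gam (n p : ℕ) (C a : ℝ) :
    Integrable (fun x : Fin n → Er p => C * Real.exp (a * ∑ i, ‖x i‖)) (gam n p) := by
  refine Integrable.const_mul ?_ C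
  simp_rw [Finset.mul_sum, Real.exp_sum]
  unfold gam
  exact Integrable.fintype_prod (ι := Fin n) (𝕜 := ℝ) (E := Er p) (μ := fun _ => gau (Er p))
    (f := fun _ (x : Er p) => Real.exp (a * ‖x‖)) (fun _ => integrable_exp_gau a)


lemma continuous_conj {n p : ℕ} : Continuous (fun r : Matrix (Fin p) (Fin p) ℂ × (Fin n → Er p) =>
      toM r.2 * r.1 * (toM r.2)ᴴ) := by
    have h1 : Continuous (fun r : Matrix (Fin p) (Fin p) ℂ × (Fin n → Er p) => toM r.2) :=
      continuous_toM.comp continuous_snd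
    exact (h1.matrix_mul continuous_fst).matrix_mul h1.matrix_conjTranspose

lemma measurable_conj0 {n p : ℕ} : Measurable (fun r : Matrix (Fin p) (Fin p) ℂ × (Fin n → Er p) =>
      toM r.2 * r.1 * (toM r.2)ᴴ) := continuous_conj.measurable

lemma measurable_conj1 {n p : ℕ} (w : ℕ → ℂ) (N : ℕ) : Measurable (fun r : Matrix (Fin p) (Fin p) ℂ × (Fin n → Er p) =>
      fprod N w (toM r.2 * r.1 * (toM r.2)ᴴ)) := (measurable_fprod N w).comp measurable_conj0

lemma measurable_conj {n p : ℕ} (w : ℕ → ℂ) (N : ℕ) {Ω : Type*} [MeasurableSpace Ω]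
    (Z : Ω → Matrix (Fin p) (Fin p) ℂ) (hZ : Measurable Z) (Y : Ω → (Fin n → Er p)) (hY : Measurable Y) :
    Measurable (fun q => fprod N w (toM (Y q) * Z q * (toM (Y q))ᴴ)) := by
  have h' : Measurable (fun q => (Z q, Y q)) := hZ.prodMk hY
  have := (measurable_conj1 w N).comp h'
  simp only [Function.comp_def] at this
  exact this

lemma integrable_prod {n p : ℕ} (w : ℕ → ℂ) (N : ℕ) (hNn : N ≤ n) (hw : ∀ j < N, 0 ≤ (w j).re)
    {Ω : Type*} [MeasurableSpace Ω]
    (μ : Measure Ω) [IsProbabilityMeasure μ] (Z : Ω → Matrix (Fin p) (Fin p) ℂ) (hZ : Measurable Z)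
    (c : ℝ) (hc : 0 ≤ c) (h : ∀ᵐ ω ∂μ, ∀ a b, ‖Z ω a b‖ ≤ c) :
    Integrable (fun q : (Fin n → Er p) × Ω => fprod N w (toM q.1 * Z q.2 * (toM q.1)ᴴ))
      ((gam n p).prod μ) := by
  obtain ⟨C, a, hC⟩ := fprod_bound N w hw hNn (p * p * c) (by positivity)
  refine Integrable.mono' ((integrable_exp_gam n p C a).comp_fst μ)
    (measurable_conj w N (fun q : (Fin n → Er p) × Ω => Z q.2) (hZ.comp measurable_snd) Prod.fst
      measurable_fst).aestronglyMeasurable ?_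
  filter_upwards [Measure.quasiMeasurePreserving_snd.ae h] with q hq
  exact hC _ _ (norm_conj_le q.1 (Z q.2) c hq)

lemma integrable_single {n p : ℕ} (w : ℕ → ℂ) (N : ℕ) (hNn : N ≤ n) (hw : ∀ j < N, 0 ≤ (w j).re) :
    Integrable (fun q : (Fin n → Er p) => fprod N w (toM q * (toM q)ᴴ)) (gam n p) := by
  obtain ⟨C, a, hC⟩ := fprod_bound N w hw hNn (p * p * 1) (by positivity)
  refine Integrable.mono' (integrable_exp_gam n p C a) ?_ (.of_forall fun q => ?_)
  · have := measurable_conj w N (fun q : (Fin n → Er p) => (1 : Matrix (Fin p) (Fin p) ℂ)) measurable_const id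
      measurable_id
    simp only [Matrix.mul_one, id] at this
    exact this.aestronglyMeasurable
  · have := norm_conj_le q 1 1 (fun a b => by rw [Matrix.one_apply]; split_ifs <;> simp)
    rw [Matrix.mul_one] at this
    exact hC _ _ this



open scoped ComplexOrder in
lemma det_conj_eq_zero {n p : ℕ} (G : Matrix (Fin n) (Fin p) ℂ) (hG : (G * Gᴴ).det = 0)
    (z : Matrix (Fin p) (Fin p) ℂ) : (G * z * Gᴴ).det = 0 := by
  obtain ⟨v, hv, hv2⟩ := Matrix.exists_vecMul_eq_zero_iff.2 hG
  refine Matrix.exists_vecMul_eq_zero_iff.1 ⟨v, hv, ?_⟩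
  have := (Matrix.vecMul_self_mul_conjTranspose_eq_zero G v).1 hv2
  rw [Matrix.mul_assoc, ← Matrix.vecMul_vecMul, this, Matrix.zero_vecMul]

lemma fprod_eq_zero {n : ℕ} (hn : 1 ≤ n) (w : ℕ → ℂ) (y : Matrix (Fin n) (Fin n) ℂ)
    (hy : y.det = 0) : fprod n w y = 0 := by
  unfold fprod
  refine Finset.prod_eq_zero (i := n - 1) (Finset.mem_range.2 (by omega)) ?_
  rw [Nat.sub_add_cancel hn, pminor_top, hy]
  simp [zpw]

lemma inner_int {n p : ℕ} (hn : 1 ≤ n) (hnp : n ≤ p) (w : ℕ → ℂ)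
    (μ : Measure (Matrix (Fin p) (Fin p) ℂ)) (hμ : IsHaarUnitary p μ)
    (x : Matrix (Fin p) (Fin p) ℂ) (G : Matrix (Fin n) (Fin p) ℂ) :
    ∫ k, fprod n w (G * (k * x * kᴴ) * Gᴴ) ∂μ =
      fprod n w (G * Gᴴ) * ∫ k, fprod n w (k * x * kᴴ) ∂μ := by
  by_cases hG : (G * Gᴴ).det = 0
  · rw [fprod_eq_zero hn w _ hG, zero_mul]
    simp_rw [fprod_eq_zero hn w _ (det_conj_eq_zero G hG _)]
    simp
  · obtain ⟨U, hU, h⟩ := exists_unitary_minor hnp G hG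
    have h1 : ∀ k : Matrix (Fin p) (Fin p) ℂ, fprod n w (G * (k * x * kᴴ) * Gᴴ)
        = fprod n w (G * Gᴴ) * fprod n w ((U * k) * x * (U * k)ᴴ) := by
      intro k
      refine fprod_mul n w _ _ _ fun j hj => ?_
      rw [h _ j hj]
      simp only [conjTranspose_mul, Matrix.mul_assoc]
    simp_rw [h1]
    rw [integral_const_mul]
    congr 1
    conv_rhs => rw [← hμ.2.2 U hU]
    rw [integral_map]
    · exact (by fun_prop : Continuous (fun A : Matrix (Fin p) (Fin p) ℂ => U * A)).measurable.aemeasurable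
    · have h3 : Measurable (fun k : Matrix (Fin p) (Fin p) ℂ => k * x * kᴴ) :=
        (by fun_prop : Continuous (fun k : Matrix (Fin p) (Fin p) ℂ => k * x * kᴴ)).measurable
      have h4 := (measurable_fprod n w (l := p)).comp h3
      simp only [Function.comp_def] at h4
      exact h4.aestronglyMeasurable

lemma norm_kxk_le {p : ℕ} (x k : Matrix (Fin p) (Fin p) ℂ) (hk : k ∈ Matrix.unitaryGroup (Fin p) ℂ)
    (a b : Fin p) : ‖(k * x * kᴴ) a b‖ ≤ ∑ i, ∑ j, ‖x i j‖ := by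
  simp only [Matrix.mul_apply, conjTranspose_apply]
  rw [Finset.sum_comm]
  refine (norm_sum_le _ _).trans (Finset.sum_le_sum fun j _ => ?_)
  rw [norm_mul, norm_star]
  refine (mul_le_of_le_one_right (norm_nonneg _) (entry_norm_bound_of_unitary hk b j)).trans ?_
  refine (norm_sum_le _ _).trans (Finset.sum_le_sum fun i _ => ?_)
  rw [norm_mul]
  exact mul_le_of_le_one_left (norm_nonneg _) (entry_norm_bound_of_unitary hk a i)

lemma main_identity {n p : ℕ} (hn : 1 ≤ n) (hnp : n ≤ p) (w : ℕ → ℂ) (hw : ∀ j < n, 0 ≤ (w j).re)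
    (μ : Measure (Matrix (Fin p) (Fin p) ℂ)) (hμ : IsHaarUnitary p μ)
    (x : Matrix (Fin p) (Fin p) ℂ) :
    (∫ G, fprod n w (toM G * (toM G)ᴴ) ∂(gam n p)) * ∫ k, fprod n w (k * x * kᴴ) ∂μ =
      ∫ G, fprod n w (toM G * x * (toM G)ᴴ) ∂(gam n p) := by
  have hpr := hμ.1
  have hae : ∀ᵐ k ∂μ, k ∈ Matrix.unitaryGroup (Fin p) ℂ := by
    rw [ae_iff]; exact hμ.2.1
  have hZ : Measurable (fun k : Matrix (Fin p) (Fin p) ℂ => k * x * kᴴ) :=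
        (by fun_prop : Continuous (fun k : Matrix (Fin p) (Fin p) ℂ => k * x * kᴴ)).measurable
  rw [← integral_mul_const]
  simp_rw [← inner_int hn hnp w μ hμ x]
  have hprod := integrable_prod (n := n) w n le_rfl hw μ (fun k => k * x * kᴴ) hZ (∑ i, ∑ j, ‖x i j‖)
    (by positivity) (by filter_upwards [hae] with k hk using norm_kxk_le x k hk)
  have hsw := integral_integral_swap
    (f := fun (G : Fin n → Er p) (k : Matrix (Fin p) (Fin p) ℂ) =>
      fprod n w (toM G * (k * x * kᴴ) * (toM G)ᴴ)) (μ := gam n p) (ν := μ) hprod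
  rw [hsw]
  have : ∀ᵐ k ∂μ, ∫ G, fprod n w (toM G * (k * x * kᴴ) * (toM G)ᴴ) ∂(gam n p)
      = ∫ G, fprod n w (toM G * x * (toM G)ᴴ) ∂(gam n p) := by
    filter_upwards [hae] with k hk
    have hk' : kᴴ * k = 1 := Matrix.mem_unitaryGroup_iff'.1 hk
    have hF : Measurable (fun H : Matrix (Fin n) (Fin p) ℂ => fprod n w (H * x * Hᴴ)) := by
      have h3 : Measurable (fun k : Matrix (Fin n) (Fin p) ℂ => k * x * kᴴ) :=
        (by fun_prop : Continuous (fun k : Matrix (Fin n) (Fin p) ℂ => k * x * kᴴ)).measurable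
      have h4 := (measurable_fprod n w (l := n)).comp h3
      simp only [Function.comp_def] at h4
      exact h4
    rw [← integral_gam_mul k hk' _ hF]
    simp only [conjTranspose_mul, Matrix.mul_assoc]
  rw [integral_congr_ae this]
  simp

/-- Reduction to the square case. -/
lemma corner {n p : ℕ} (w : ℕ → ℂ) (V : Matrix (Fin p) (Fin n) ℂ) (hV : Vᴴ * V = 1)
    (d : Matrix (Fin n) (Fin n) ℂ) :
    ∫ G, fprod n w (toM G * (V * d * Vᴴ) * (toM G)ᴴ) ∂(gam n p) =
      ∫ G, fprod n w (toM G * d * (toM G)ᴴ) ∂(gam n n) := by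
  have hF : Measurable (fun H : Matrix (Fin n) (Fin n) ℂ => fprod n w (H * d * Hᴴ)) := by
    have h3 : Measurable (fun k : Matrix (Fin n) (Fin n) ℂ => k * d * kᴴ) :=
      (by fun_prop : Continuous (fun k : Matrix (Fin n) (Fin n) ℂ => k * d * kᴴ)).measurable
    have h4 := (measurable_fprod n w (l := n)).comp h3
    simp only [Function.comp_def] at h4
    exact h4
  rw [← integral_gam_mul V hV _ hF]
  simp only [conjTranspose_mul, Matrix.mul_assoc]


/-- append a row -/
def addRow {n p : ℕ} (G : Matrix (Fin n) (Fin p) ℂ) (r : Er p) : Matrix (Fin (n+1)) (Fin p) ℂ :=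
  Matrix.of (Fin.snoc (α := fun _ => Fin p → ℂ) (fun i j => G i j) (fun j => r j))

lemma addRow_castSucc {n p : ℕ} (G : Matrix (Fin n) (Fin p) ℂ) (r : Er p) (i : Fin n) (j : Fin p) :
    addRow G r i.castSucc j = G i j := by
  simp [addRow]

lemma addRow_last {n p : ℕ} (G : Matrix (Fin n) (Fin p) ℂ) (r : Er p) (j : Fin p) :
    addRow G r (Fin.last n) j = r j := by
  simp [addRow]

lemma schur {n m : ℕ} (G : Matrix (Fin n) (Fin (n+m)) ℂ) (hG : (G * Gᴴ).det ≠ 0) :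
    ∃ W : Matrix (Fin (n+m)) (Fin m) ℂ, Wᴴ * W = 1 ∧ ∀ r : Er (n+m),
      pminor (addRow G r * (addRow G r)ᴴ) (n+1) = pminor (G * Gᴴ) n * ‖rowL W r‖ ^ 2 := by
  obtain ⟨T, hT, hK⟩ := exists_LQ G hG
  obtain ⟨U, hU, hUK⟩ := exists_unitary (Nat.le_add_right n m) _ hK
  have hU1 : U * Uᴴ = 1 := Matrix.mem_unitaryGroup_iff.1 hU
  have hU2 : Uᴴ * U = 1 := Matrix.mem_unitaryGroup_iff'.1 hU
  let W : Matrix (Fin (n+m)) (Fin m) ℂ := Uᴴ.submatrix id (Fin.natAdd n)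
  have hsum : (T * G)ᴴ * (T * G) + W * Wᴴ = 1 := by
    rw [← hU2, ← hUK]
    ext a b
    simp only [Matrix.add_apply, Matrix.mul_apply, conjTranspose_apply, submatrix_apply, W, id,
      Fin.sum_univ_add, star_star]
    rfl
  refine ⟨W, ?_, fun r => ?_⟩
  · ext a b
    have := congrFun (congrFun hU1 (Fin.natAdd n a)) (Fin.natAdd n b)
    simp only [Matrix.mul_apply, conjTranspose_apply, submatrix_apply, W, id, star_star,
      Matrix.one_apply] at this ⊢
    rw [this]
    simp
  · rw [pminor_top, pminor_top]
    let R : Matrix (Fin 1) (Fin (n+m)) ℂ := Matrix.of fun _ j => r j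
    have hb : (addRow G r * (addRow G r)ᴴ).submatrix finSumFinEquiv finSumFinEquiv
        = fromBlocks (G * Gᴴ) (G * Rᴴ) (R * Gᴴ) (R * Rᴴ) := by
      have e1 : ∀ i : Fin n, addRow G r (Fin.castAdd 1 i) = fun j => G i j := by
        intro i; funext j; exact addRow_castSucc G r i j
      have e2 : ∀ i : Fin 1, addRow G r (Fin.natAdd n i) = fun j => r j := by
        intro i
        have : Fin.natAdd n i = Fin.last n := by ext; simp
        rw [this]; funext j; exact addRow_last G r j
      ext a b
      rcases a with a | a <;> rcases b with b | b <;>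
        simp [Matrix.mul_apply, e1, e2, R]
    rw [← Matrix.det_submatrix_equiv_self finSumFinEquiv, hb]
    have hS : IsUnit (G * Gᴴ) := (Matrix.isUnit_iff_isUnit_det _).2 (isUnit_iff_ne_zero.2 hG)
    let _ := hS.invertible
    rw [Matrix.det_fromBlocks₁₁]
    have hinv : ⅟(G * Gᴴ) = Tᴴ * T := by
      have h1 : T * ((G * Gᴴ) * Tᴴ) = 1 := by
        rw [← hK]; simp only [conjTranspose_mul, Matrix.mul_assoc]
      have h2 := mul_eq_one_comm.1 h1
      rw [Matrix.mul_assoc] at h2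
      exact invOf_eq_right_inv h2
    have h3 : R * Rᴴ - R * Gᴴ * ⅟(G * Gᴴ) * (G * Rᴴ) = (R * W) * (R * W)ᴴ := by
      have : W * Wᴴ = 1 - (T * G)ᴴ * (T * G) := eq_sub_of_add_eq' hsum
      calc _ = R * (1 - (T * G)ᴴ * (T * G)) * Rᴴ := by
            rw [hinv]
            simp only [conjTranspose_mul, Matrix.mul_sub, Matrix.sub_mul, Matrix.mul_one, Matrix.mul_assoc]
        _ = _ := by rw [← this]; simp only [conjTranspose_mul, Matrix.mul_assoc]
    rw [h3, Matrix.det_fin_one]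
    have h4 : ((R * W) * (R * W)ᴴ) 0 0 = ((‖rowL W r‖ ^ 2 : ℝ) : ℂ) := by
      rw [PiLp.norm_sq_eq_of_L2]
      rw [Matrix.mul_apply]
      push_cast
      refine Finset.sum_congr rfl fun j _ => ?_
      rw [conjTranspose_apply, Complex.star_def, Complex.mul_conj, Complex.normSq_eq_norm_sq]
      push_cast
      rfl
    rw [h4, Complex.re_mul_ofReal]

lemma pminor_addRow {n p : ℕ} (G : Matrix (Fin n) (Fin p) ℂ) (r : Er p) (j : ℕ) (hj : j ≤ n) :
    pminor (addRow G r * (addRow G r)ᴴ) j = pminor (G * Gᴴ) j := by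
  rw [← pminor_sub (Nat.le_succ n) _ j hj]
  congr 1
  have e1 : ∀ i : Fin n, addRow G r (Fin.castLE (Nat.le_succ n) i) = fun j => G i j := by
    intro i; funext j; exact addRow_castSucc G r i j
  ext a b
  simp [Matrix.mul_apply, e1]

/-- shifted exponents -/
def wsh (n : ℕ) (w : ℕ → ℂ) : ℕ → ℂ := fun j => if j + 1 = n then w j + w n else w j

lemma fprod_wsh {n : ℕ} (w : ℕ → ℂ) (y : Matrix (Fin n) (Fin n) ℂ) :
    fprod n w y * zpw (w n) (pminor y n) = fprod n (wsh n w) y := by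
  cases n with
  | zero => simp [fprod, pminor_top, zpw_one]
  | succ k =>
    unfold fprod
    rw [Finset.prod_range_succ, Finset.prod_range_succ, mul_assoc]
    congr 1
    · refine Finset.prod_congr rfl fun j hj => ?_
      rw [Finset.mem_range] at hj
      simp [wsh, hj.ne]
    · simp [wsh, zpw_add]

lemma inner_row {n m : ℕ} (w : ℕ → ℂ) (G : Matrix (Fin n) (Fin (n+m)) ℂ) :
    ∫ r, fprod (n+1) w (addRow G r * (addRow G r)ᴴ) ∂(gau (Er (n+m)))
      = fprod n (wsh n w) (G * Gᴴ) * ∫ x, zpw (w n) (‖x‖ ^ 2) ∂(gau (Er m)) := by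
  have h0 : ∀ r, fprod (n+1) w (addRow G r * (addRow G r)ᴴ) = fprod n w (G * Gᴴ) *
      zpw (w n) (pminor (addRow G r * (addRow G r)ᴴ) (n+1)) := by
    intro r
    rw [← fprod_congr n w (addRow G r * (addRow G r)ᴴ) (G * Gᴴ) (pminor_addRow G r)]
    unfold fprod
    rw [Finset.prod_range_succ]
  by_cases hG : (G * Gᴴ).det = 0
  · have hn : 1 ≤ n := by
      by_contra h
      have : n = 0 := by omega
      subst this
      simp at hG
    simp_rw [h0, fprod_eq_zero hn _ _ hG]
    simp
  · obtain ⟨W, hW, h⟩ := schur G hG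
    simp_rw [h0, h, zpw_mul, ← mul_assoc, fprod_wsh]
    rw [integral_const_mul]
    congr 1
    rw [← map_row W hW, integral_map (continuous_rowL W).measurable.aemeasurable]
    exact ((measurable_zpw _).comp (by fun_prop)).aestronglyMeasurable

instance sf_gau (p : ℕ) : SigmaFinite (gau (Er p)) := inferInstance

lemma Mint_ne_zero (p n : ℕ) : ∀ (_ : n ≤ p) (w : ℕ → ℂ) (_ : ∀ j < n, 0 ≤ (w j).re),
    ∫ G, fprod n w (toM G * (toM G)ᴴ) ∂(gam n p) ≠ 0 := by
  induction n with
  | zero => intro _ w _; simp [fprod]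
  | succ n ih =>
    intro hnp w hw
    obtain ⟨m, rfl⟩ : ∃ m, p = n + (m + 1) := ⟨p - n - 1, by omega⟩
    have hi := integrable_single (n := n+1) (p := n + (m+1)) w (n+1) le_rfl hw
    have sf : ∀ i : Fin (n+1), SigmaFinite ((fun _ : Fin (n+1) => gau (Er (n + (m+1)))) i) :=
      fun _ => sf_gau _
    have mp := (measurePreserving_piFinSuccAbove (fun _ : Fin (n+1) => gau (Er (n + (m+1))))
      (Fin.last n)).symm
    have hi2 := (mp.integrable_comp_emb (MeasurableEquiv.measurableEmbedding _)).2 hi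
    have e : ∀ q : Er (n + (m+1)) × (Fin n → Er (n + (m+1))),
        toM ((MeasurableEquiv.piFinSuccAbove (fun _ : Fin (n+1) => Er (n + (m+1)))
          (Fin.last n)).symm q) = addRow (toM q.2) q.1 := by
      rintro ⟨r, G⟩
      have : (MeasurableEquiv.piFinSuccAbove (fun _ : Fin (n+1) => Er (n + (m+1)))
          (Fin.last n)).symm (r, G) = Fin.snoc (α := fun _ => Er (n + (m+1))) G r := by
        simp [MeasurableEquiv.piFinSuccAbove_symm_apply, Fin.insertNthEquiv, Fin.insertNth_last']
      rw [this]
      ext i j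
      refine Fin.lastCases ?_ (fun i => ?_) i
      · simp [toM, addRow]
      · simp [toM, addRow]
    have h1 : ∫ G, fprod (n+1) w (toM G * (toM G)ᴴ) ∂(gam (n+1) (n + (m+1)))
        = ∫ q, fprod (n+1) w (addRow (toM q.2) q.1 * (addRow (toM q.2) q.1)ᴴ)
          ∂((gau (Er (n + (m+1)))).prod (gam n (n + (m+1)))) := by
      unfold gam
      rw [← mp.integral_comp']
      simp_rw [e]
    simp only [Function.comp_def, e] at hi2
    change Integrable _ ((gau (Er (n + (m+1)))).prod (gam n (n + (m+1)))) at hi2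
    rw [h1, integral_prod_symm _ hi2]
    simp_rw [inner_row]
    rw [integral_mul_const]
    refine mul_ne_zero (ih (by omega) _ ?_) (moment_gau _ (hw n (by omega)))
    intro j hj
    unfold wsh
    split_ifs with h
    · have := hw j (by omega)
      have := hw n (by omega)
      rw [Complex.add_re]; linarith
    · exact hw j (by omega)



lemma sum_nonzero {l n : ℕ} {c : Fin l → ℝ} (e : Fin n ≃ {i : Fin l // c i ≠ 0}) (f : Fin l → ℂ)
    (hf : ∀ i, c i = 0 → f i = 0) : ∑ i, f i = ∑ a, f (e a) := by
  classical
  rw [Equiv.sum_comp e (fun i : {i : Fin l // c i ≠ 0} => f i)]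
  rw [← Finset.sum_subtype (Finset.univ.filter fun i => c i ≠ 0) (by simp) f]
  rw [Finset.sum_filter]
  refine Finset.sum_congr rfl fun i _ => ?_
  split_ifs with h
  · rfl
  · exact hf i (not_not.1 h)

open scoped ComplexOrder in
lemma exists_svd {l m n : ℕ} (g : Matrix (Fin l) (Fin m) ℂ) (hg : g.rank = n) :
    ∃ (U : Matrix (Fin l) (Fin n) ℂ) (W : Matrix (Fin m) (Fin n) ℂ) (d : Matrix (Fin n) (Fin n) ℂ),
      Uᴴ * U = 1 ∧ Wᴴ * W = 1 ∧ g * gᴴ = U * d * Uᴴ ∧ gᴴ * g = W * d * Wᴴ := by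
  classical
  have hA : (g * gᴴ).IsHermitian := Matrix.isHermitian_mul_conjTranspose_self g
  obtain ⟨Q, c, hQ, hc, hr⟩ : ∃ (Q : Matrix (Fin l) (Fin l) ℂ) (c : Fin l → ℝ),
      Q ∈ Matrix.unitaryGroup (Fin l) ℂ ∧
      g * gᴴ = Q * diagonal (fun i => (c i : ℂ)) * Qᴴ ∧
      Fintype.card {i : Fin l // c i ≠ 0} = n := by
    refine ⟨hA.eigenvectorUnitary, hA.eigenvalues, hA.eigenvectorUnitary.2, ?_, ?_⟩
    · have := hA.spectral_theorem
      conv_lhs => rw [this]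
      rfl
    · rw [← hA.rank_eq_card_non_zero_eigs, Matrix.rank_self_mul_conjTranspose, hg]
  have hQ1 : Q * Qᴴ = 1 := Matrix.mem_unitaryGroup_iff.1 hQ
  have hQ2 : Qᴴ * Q = 1 := Matrix.mem_unitaryGroup_iff'.1 hQ
  let e : Fin n ≃ {i : Fin l // c i ≠ 0} := (Fintype.equivFinOfCardEq hr).symm
  obtain ⟨B, hBd⟩ : ∃ B : Matrix (Fin l) (Fin m) ℂ, B = Qᴴ * g := ⟨_, rfl⟩
  have hB : B * Bᴴ = diagonal (fun i => (c i : ℂ)) := by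
    calc B * Bᴴ = Qᴴ * (g * gᴴ) * Q := by
          simp only [hBd, conjTranspose_mul, conjTranspose_conjTranspose, Matrix.mul_assoc]
      _ = (Qᴴ * Q) * diagonal (fun i => (c i : ℂ)) * (Qᴴ * Q) := by
          rw [hc]; simp only [Matrix.mul_assoc]
      _ = _ := by rw [hQ2, Matrix.one_mul, Matrix.mul_one]
  have hn2 : ∀ i, ((∑ j, ‖B i j‖ ^ 2 : ℝ) : ℂ) = c i := by
    intro i
    have := congrFun (congrFun hB i) i
    rw [diagonal_apply_eq, Matrix.mul_apply] at this
    rw [← this]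
    push_cast
    refine Finset.sum_congr rfl fun j _ => ?_
    rw [conjTranspose_apply, Complex.star_def, Complex.mul_conj, Complex.normSq_eq_norm_sq]
    push_cast
    rfl
  have hn3 : ∀ i, ∑ j, ‖B i j‖ ^ 2 = c i := fun i => Complex.ofReal_injective (hn2 i)
  have hc0 : ∀ i, 0 ≤ c i := fun i => by rw [← hn3]; positivity
  have hB0 : ∀ i, c i = 0 → ∀ j, B i j = 0 := by
    intro i hi j
    have h := hn3 i
    rw [hi, Finset.sum_eq_zero_iff_of_nonneg (fun _ _ => by positivity)] at h
    simpa using h j (Finset.mem_univ j)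
  have hBB : gᴴ * g = Bᴴ * B := by
    calc gᴴ * g = gᴴ * (Q * Qᴴ) * g := by rw [hQ1, Matrix.mul_one]
      _ = _ := by simp only [hBd, conjTranspose_mul, conjTranspose_conjTranspose, Matrix.mul_assoc]
  have hinj : ∀ a b : Fin n, ((e a : Fin l) = e b) ↔ a = b := by
    intro a b
    rw [← Subtype.ext_iff, e.injective.eq_iff]
  have hpos : ∀ a, 0 < Real.sqrt (c (e a)) := fun a =>
    Real.sqrt_pos.2 (lt_of_le_of_ne (hc0 _) (Ne.symm (e a).2))
  have hsq : ∀ a, ((Real.sqrt (c (e a)) : ℝ) : ℂ) * ((Real.sqrt (c (e a)) : ℝ) : ℂ) = (c (e a) : ℂ) := by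
    intro a
    rw [← Complex.ofReal_mul, Real.mul_self_sqrt (hc0 _)]
  have hne : ∀ a, ((Real.sqrt (c (e a)) : ℝ) : ℂ) ≠ 0 := fun a =>
    Complex.ofReal_ne_zero.2 (hpos a).ne'
  refine ⟨Q.submatrix id (fun a => (e a : Fin l)),
    Matrix.of fun j a => star (B (e a) j) * ((Real.sqrt (c (e a)) : ℝ) : ℂ)⁻¹,
    diagonal (fun a => (c (e a) : ℂ)), ?_, ?_, ?_, ?_⟩
  · ext a b
    have := congrFun (congrFun hQ2 (e a)) (e b)
    simp only [Matrix.mul_apply, conjTranspose_apply, submatrix_apply, id, Matrix.one_apply,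
      hinj] at this ⊢
    exact this
  · ext a b
    have := congrFun (congrFun hB (e a)) (e b)
    simp only [Matrix.mul_apply, conjTranspose_apply, diagonal_apply, hinj] at this
    simp only [Matrix.mul_apply, conjTranspose_apply, Matrix.one_apply, of_apply, star_mul',
      Complex.conj_conj, star_inv₀, Complex.star_def, Complex.conj_ofReal] at this ⊢
    have h2 : ∀ x, B (e a) x * ((Real.sqrt (c (e a)) : ℝ) : ℂ)⁻¹ *
        ((starRingEnd ℂ) (B (e b) x) * ((Real.sqrt (c (e b)) : ℝ) : ℂ)⁻¹) =
        (B (e a) x * (starRingEnd ℂ) (B (e b) x)) *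
        (((Real.sqrt (c (e a)) : ℝ) : ℂ)⁻¹ * ((Real.sqrt (c (e b)) : ℝ) : ℂ)⁻¹) := fun x => by ring
    rw [Finset.sum_congr rfl fun x _ => h2 x, ← Finset.sum_mul, this]
    split_ifs with h
    · subst h
      rw [← hsq]
      have := hne a
      field_simp
    · simp
  · rw [hc]
    ext i j
    rw [Matrix.mul_apply, Matrix.mul_apply]
    simp only [mul_diagonal, conjTranspose_apply, submatrix_apply, id]
    rw [sum_nonzero e]
    intro i hi
    simp [hi]
  · rw [hBB]
    ext i j
    rw [Matrix.mul_apply, Matrix.mul_apply]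
    simp only [mul_diagonal, conjTranspose_apply, of_apply]
    rw [sum_nonzero e]
    · refine Finset.sum_congr rfl fun a _ => ?_
      rw [← hsq a]
      have := hne a
      simp only [star_mul', Complex.conj_conj, star_inv₀, Complex.star_def, Complex.conj_ofReal]
      field_simp
    · intro i hi
      simp [hB0 i hi]

lemma projMat_eq {p n : ℕ} (hnp : n ≤ p) :
    ∃ V : Matrix (Fin p) (Fin n) ℂ, Vᴴ * V = 1 ∧ projMat p n = V * (1 : Matrix (Fin n) (Fin n) ℂ) * Vᴴ := by
  refine ⟨(1 : Matrix (Fin p) (Fin p) ℂ).submatrix id (Fin.castLE hnp), ?_, ?_⟩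
  · ext a b
    simp [Matrix.mul_apply, Matrix.one_apply, eq_comm]
  · obtain ⟨q, rfl⟩ := Nat.exists_eq_add_of_le hnp
    rw [Matrix.mul_one]
    ext a b
    simp only [projMat, Matrix.mul_apply, diagonal_apply, conjTranspose_apply, submatrix_apply, id,
      Matrix.one_apply]
    by_cases hab : a = b
    · subst hab
      by_cases ha : (a : ℕ) < n
      · rw [Finset.sum_eq_single (⟨a, ha⟩ : Fin n)]
        · simp [ha]
        · intro c _ hc
          have : ¬ (a = Fin.castLE hnp c) := fun h => hc (Fin.ext (congrArg Fin.val h).symm)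
          simp [this]
        · simp
      · rw [Finset.sum_eq_zero]
        · simp [ha]
        · intro c _
          have : ¬ (a = Fin.castLE hnp c) := fun h => ha (by rw [h]; exact c.2)
          simp [this]
    · rw [Finset.sum_eq_zero]
      · simp [hab]
      · intro c _
        by_cases h : a = Fin.castLE hnp c
        · have : ¬ (b = Fin.castLE hnp c) := fun h' => hab (h.trans h'.symm)
          simp [this]
        · simp [h]

open scoped ComplexOrder in
lemma psi_eq (l m n : ℕ) (hn : 1 ≤ n) (hnl : n ≤ l)
    (g : Matrix (Fin l) (Fin m) ℂ)
    (s : ℕ → ℂ) (hs : ∀ j < n, 1 ≤ (s j - sNext n s j).re)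
    (μl : Measure (Matrix (Fin l) (Fin l) ℂ)) (hμl : IsHaarUnitary l μl)
    (U : Matrix (Fin l) (Fin n) ℂ) (d : Matrix (Fin n) (Fin n) ℂ) (hU : Uᴴ * U = 1)
    (hg : g * gᴴ = U * d * Uᴴ) :
    Psi l m n μl s g = (∫ G, fprod n (fun j => s j - sNext n s j - 1) (toM G * d * (toM G)ᴴ) ∂(gam n n)) /
      ∫ G, fprod n (fun j => s j - sNext n s j - 1) (toM G * 1 * (toM G)ᴴ) ∂(gam n n) := by
  have hw : ∀ j < n, 0 ≤ ((fun j => s j - sNext n s j - 1) j).re := by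
    intro j hj
    have := hs j hj
    simp only [Complex.sub_re, Complex.one_re] at this ⊢
    linarith
  have hM := Mint_ne_zero l n hnl _ hw
  obtain ⟨V, hV, hP⟩ := projMat_eq hnl
  have h1 : Nsph l n μl s (Lstd n) (g * gᴴ) =
      ∫ k, fprod n (fun j => s j - sNext n s j - 1) (k * (g * gᴴ) * kᴴ) ∂μl := by
    unfold Nsph
    refine integral_congr_ae (Eventually.of_forall fun k => ?_)
    exact sphProd_eq n s _ hnl _
      ((Matrix.posSemidef_self_mul_conjTranspose g).mul_mul_conjTranspose_same k)
  have h2 : Csph l n μl s =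
      ∫ k, fprod n (fun j => s j - sNext n s j - 1) (k * projMat l n * kᴴ) ∂μl := rfl
  have m1 := main_identity hn hnl _ hw μl hμl (g * gᴴ)
  have m2 := main_identity hn hnl _ hw μl hμl (projMat l n)
  rw [← h1] at m1
  rw [← h2] at m2
  rw [hg, corner _ U hU] at m1
  rw [hP, corner _ V hV] at m2
  unfold Psi Phi
  rw [← m1, ← m2, mul_div_mul_left _ _ hM, hg]

/-- The spherical functions of `g` and of `g*` coincide:
`Φ_{l,n}(s, L^{(n)}; g g*) = Φ_{m,n}(s, L^{(n)}; g* g)`, i.e. `Ψ(s;g) = Ψ(s;g*)`. -/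
theorem statement4 (l m n : ℕ) (hn : 1 ≤ n) (hnl : n ≤ l) (hnm : n ≤ m)
    (g : Matrix (Fin l) (Fin m) ℂ) (hg : g.rank = n)
    (s : ℕ → ℂ) (hs : ∀ j < n, 1 ≤ (s j - sNext n s j).re)
    (μl : Measure (Matrix (Fin l) (Fin l) ℂ)) (hμl : IsHaarUnitary l μl)
    (μm : Measure (Matrix (Fin m) (Fin m) ℂ)) (hμm : IsHaarUnitary m μm) :
    Psi l m n μl s g = Psi m l n μm s gᴴ := by
  obtain ⟨U, W, d, hU, hW, h1, h2⟩ := exists_svd g hg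
  rw [psi_eq l m n hn hnl g s hs μl hμl U d hU h1,
    psi_eq m l n hn hnm gᴴ s hs μm hμm W d hW (by rw [conjTranspose_conjTranspose]; exact h2)]


end RMT
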